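/- Proposition 1(a) (linear convergence of SAGA under any non-uniform sampling): Let E be a real inner product space, let n ≥ 1, and let f_1, …, f_n : E → ℝ each be μ-strongly convex and differentiable with L-Lipschitz continuous gradient, where 0 < μ ≤ L. Let f = (1/n)∑_{i=1}^n f_i with minimizer x*. Let p_1, …, p_n be positive reals summing to 1, set p_min = min_j p_j and step size α = n p_min/(4L + nμ). Starting from x⁰ ∈ E and φ⁰_i = x⁰ for all i (equivalently, stored gradients initialized at ∇f_i(x⁰)), run the recursion: at step t, sample j_t = j with probability p_j independently of the past, set x^{t+1} = x^t − α[ (1/(n p_{j_t}))(∇f_{j_t}(x^t) − s^t_{j_t}) + (1/n)∑_{i=1}^n s^t_i ], and update s^{t+1}_{j_t} = ∇f_{j_t}(x^t) while s^{t+1}_j = s^t_j for j ≠ j_t, where s⁰_i = ∇f_i(φ⁰_i). Then for every t ≥ 0, the expectation over all length-t index sequences (with path σ ∈ {1,…,n}^t weighted by ∏_{k<t} p_{σ_k}) satisfies E[‖x^t − x*‖²] ≤ (1 − μα)^t [ ‖x⁰ − x*‖² + C_a ], where C_a = (2 p_min/(4L + nμ)²) ∑_{i=1}^n (1/p_i)‖∇f_i(x⁰)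 − ∇f_i(x*)‖². -/

import Mathlib

open scoped BigOperators

open scoped InnerProductSpace

section SmoothConvex

variable {E : Type*} [NormedAddCommGroup E] [InnerProductSpace ℝ E] [CompleteSpace E]

/-- The derivative of a differentiable function along a line. -/
lemma hasDerivAt_comp_line {f : E → ℝ} (hf : Differentiable ℝ f) (x d : E) (t : ℝ) :
    HasDerivAt (fun t : ℝ => f (x + t • d)) ⟪gradient f (x + t • d), d⟫_ℝ t := by
  have h1 : HasDerivAt (fun t : ℝ => x + t • d) d t := by
    simpa using ((hasDerivAt_id t).smul_const d).const_add x
  have h2 := (hf (x + t • d)).hasGradientAt.hasFDerivAt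
  simpa [Function.comp_def] using h2.comp_hasDerivAt t h1

/-- The quadratic lower bound satisfied by a differentiable strongly convex function. -/
lemma quadratic_lower_bound {f : E → ℝ} {μ : ℝ} (hf : Differentiable ℝ f)
    (hsc : ConvexOn ℝ Set.univ (fun w => f w - μ / 2 * ‖w‖ ^ 2)) (x y : E) :
    f x + ⟪gradient f x, y - x⟫_ℝ + μ / 2 * ‖y - x‖ ^ 2 ≤ f y := by
  have hconv := hsc.comp_affineMap (AffineMap.lineMap x y : ℝ →ᵃ[ℝ] E)
  have hline : ∀ t : ℝ, (AffineMap.lineMap x y : ℝ →ᵃ[ℝ] E) t = x + t • (y - x) := by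
    intro t
    rw [AffineMap.lineMap_apply_module']
    abel
  have h1 : HasDerivAt (fun t : ℝ => x + t • (y - x)) (y - x) 0 := by
    simpa using ((hasDerivAt_id (0 : ℝ)).smul_const (y - x)).const_add x
  have hder : HasDerivAt
      ((fun w => f w - μ / 2 * ‖w‖ ^ 2) ∘ (AffineMap.lineMap x y : ℝ →ᵃ[ℝ] E))
      (⟪gradient f x, y - x⟫_ℝ - μ / 2 * (2 * ⟪x, y - x⟫_ℝ)) 0 := by
    have h2 := (hasDerivAt_comp_line hf x (y - x) 0).sub (h1.norm_sq.const_mul (μ / 2))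
    simp only [zero_smul, add_zero] at h2
    refine h2.congr_of_eventuallyEq (Filter.Eventually.of_forall fun t => ?_)
    simp [hline]
  have hslope := hconv.le_slope_of_hasDerivAt (Set.mem_univ _) (Set.mem_univ _)
    (zero_lt_one' ℝ) hder
  simp only [slope_def_field, Function.comp_apply, AffineMap.lineMap_apply_one,
    AffineMap.lineMap_apply_zero, sub_zero, div_one] at hslope
  have hexp : ‖y - x‖ ^ 2 = ‖y‖ ^ 2 - ‖x‖ ^ 2 - 2 * ⟪x, y - x⟫_ℝ := by
    rw [norm_sub_sq_real, inner_sub_right, real_inner_self_eq_norm_sq, real_inner_comm]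
    ring
  rw [hexp]
  linarith

/-- The quadratic upper bound satisfied by a function with Lipschitz gradient. -/
lemma quadratic_upper_bound {f : E → ℝ} {L : ℝ} (hf : Differentiable ℝ f)
    (hlip : ∀ w v : E, ‖gradient f w - gradient f v‖ ≤ L * ‖w - v‖) (x y : E) :
    f y ≤ f x + ⟪gradient f x, y - x⟫_ℝ + L / 2 * ‖y - x‖ ^ 2 := by
  set d := y - x with hd
  have hder : ∀ t : ℝ, HasDerivAt
      (fun t : ℝ => f (x + t • d) - t * ⟪gradient f x, d⟫_ℝ - t ^ 2 * (L / 2 * ‖d‖ ^ 2))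
      (⟪gradient f (x + t • d), d⟫_ℝ - ⟪gradient f x, d⟫_ℝ - 2 * t * (L / 2 * ‖d‖ ^ 2)) t := by
    intro t
    refine ((hasDerivAt_comp_line hf x d t).sub ?_).sub ?_
    · simpa using (hasDerivAt_id t).mul_const ⟪gradient f x, d⟫_ℝ
    · simpa using ((hasDerivAt_id t).pow 2).mul_const (L / 2 * ‖d‖ ^ 2)
  have hanti := antitoneOn_of_deriv_nonpos (convex_Ici (0 : ℝ))
    (fun t _ => (hder t).continuousAt.continuousWithinAt)
    (fun t _ => (hder t).differentiableAt.differentiableWithinAt) (fun t ht => by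
      rw [interior_Ici, Set.mem_Ioi] at ht
      rw [(hder t).deriv, ← inner_sub_left]
      have h1 := real_inner_le_norm (gradient f (x + t • d) - gradient f x) d
      have h2 := hlip (x + t • d) x
      rw [add_sub_cancel_left, norm_smul, Real.norm_of_nonneg ht.le] at h2
      nlinarith [mul_le_mul_of_nonneg_right h2 (norm_nonneg d)])
  have h01 := hanti (Set.self_mem_Ici) (Set.mem_Ici.2 zero_le_one) (zero_le_one' ℝ)
  have hxy : x + d = y := by rw [hd]; abel
  simp only [one_smul, zero_smul, add_zero, hxy] at h01
  linarith

/-- The gradient of a differentiable strongly convex function is strongly monotone. -/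
lemma gradient_strongly_monotone {f : E → ℝ} {μ : ℝ} (hf : Differentiable ℝ f)
    (hsc : ConvexOn ℝ Set.univ (fun w => f w - μ / 2 * ‖w‖ ^ 2)) (x y : E) :
    μ * ‖x - y‖ ^ 2 ≤ ⟪x - y, gradient f x - gradient f y⟫_ℝ := by
  have h1 := quadratic_lower_bound hf hsc x y
  have h2 := quadratic_lower_bound hf hsc y x
  rw [norm_sub_rev y x, ← neg_sub x y, inner_neg_right] at h1
  rw [real_inner_comm, inner_sub_left]
  linarith

/-- The gradient of a smooth convex function is cocoercive. -/
lemma gradient_cocoercive {f : E → ℝ} {μ L : ℝ} (hμ : 0 ≤ μ) (hL : 0 < L)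
    (hf : Differentiable ℝ f)
    (hsc : ConvexOn ℝ Set.univ (fun w => f w - μ / 2 * ‖w‖ ^ 2))
    (hlip : ∀ w v : E, ‖gradient f w - gradient f v‖ ≤ L * ‖w - v‖) (x y : E) :
    ‖gradient f x - gradient f y‖ ^ 2 ≤ L * ⟪x - y, gradient f x - gradient f y⟫_ℝ := by
  have key : ∀ x y : E, f x + ⟪gradient f x, y - x⟫_ℝ
      + 1 / (2 * L) * ‖gradient f y - gradient f x‖ ^ 2 ≤ f y := by
    intro x y
    set z := y - L⁻¹ • (gradient f y - gradient f x) with hz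
    have h1 := quadratic_lower_bound hf hsc x z
    have h2 := quadratic_upper_bound hf hlip y z
    have h3 : z - y = -(L⁻¹ • (gradient f y - gradient f x)) := by rw [hz]; abel
    have h4 : z - x = (y - x) - L⁻¹ • (gradient f y - gradient f x) := by rw [hz]; abel
    have h5 : ⟪gradient f y, gradient f y - gradient f x⟫_ℝ
        - ⟪gradient f x, gradient f y - gradient f x⟫_ℝ
        = ‖gradient f y - gradient f x‖ ^ 2 := by
      rw [← inner_sub_left, real_inner_self_eq_norm_sq]
    have h6 : 0 ≤ μ / 2 * ‖z - x‖ ^ 2 := by positivity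
    rw [h3, inner_neg_right, norm_neg, norm_smul, inner_smul_right, mul_pow,
      Real.norm_of_nonneg (inv_nonneg.2 hL.le)] at h2
    rw [h4, inner_sub_right, inner_smul_right, ← h4] at h1
    have h7 : L / 2 * (L⁻¹ ^ 2 * ‖gradient f y - gradient f x‖ ^ 2)
        = 1 / (2 * L) * ‖gradient f y - gradient f x‖ ^ 2 := by field_simp
    have h8 : L⁻¹ * ‖gradient f y - gradient f x‖ ^ 2
        = 2 * (1 / (2 * L) * ‖gradient f y - gradient f x‖ ^ 2) := by field_simp
    rw [h7] at h2
    rw [← h5, mul_sub, h5] at h8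
    linarith
  have h1 := key x y
  have h2 := key y x
  rw [norm_sub_rev, ← neg_sub x y, inner_neg_right] at h1
  have h3 : 1 / L * ‖gradient f x - gradient f y‖ ^ 2
      ≤ ⟪x - y, gradient f x - gradient f y⟫_ℝ := by
    rw [real_inner_comm, inner_sub_left]
    have : 1 / L * ‖gradient f x - gradient f y‖ ^ 2
        = 2 * (1 / (2 * L) * ‖gradient f x - gradient f y‖ ^ 2) := by field_simp
    linarith
  rwa [one_div, inv_mul_le_iff₀ hL] at h3

/-- The gradients of the summands cancel at a minimizer of the average. -/
lemma sum_gradient_eq_zero_of_forall_le {ι : Type*} [Fintype ι] {f : ι → E → ℝ} {c : ℝ}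
    (hc : 0 < c) (hf : ∀ i, Differentiable ℝ (f i)) {z : E}
    (hmin : ∀ w, c * ∑ i, f i z ≤ c * ∑ i, f i w) :
    ∑ i, gradient (f i) z = 0 := by
  have hder : HasFDerivAt (fun w => ∑ i, f i w)
      (∑ i, InnerProductSpace.toDual ℝ E (gradient (f i) z)) z :=
    HasFDerivAt.fun_sum fun i _ => (hf i z).hasGradientAt.hasFDerivAt
  have hloc : IsLocalMin (fun w => ∑ i, f i w) z :=
    Filter.Eventually.of_forall fun w => le_of_mul_le_mul_left (hmin w) hc
  have h := hloc.hasFDerivAt_eq_zero hder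
  rwa [← map_sum, LinearIsometryEquiv.map_eq_zero_iff] at h

end SmoothConvex

section Sampling

/-- Expanding an average over paths according to the last sampled index. -/
lemma sum_path_succ {ι : Type*} [Fintype ι] (p : ι → ℝ) {t : ℕ} (F : (Fin (t + 1) → ι) → ℝ) :
    ∑ σ : Fin (t + 1) → ι, (∏ k, p (σ k)) * F σ
      = ∑ τ : Fin t → ι, (∏ k, p (τ k)) * ∑ j, p j * F (Fin.snoc (α := fun _ => ι) τ j) := by
  rw [← (Fin.snocEquiv fun _ : Fin (t + 1) => ι).sum_comp, Fintype.sum_prod_type_right]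
  refine Finset.sum_congr rfl fun τ _ => ?_
  rw [Finset.mul_sum]
  refine Finset.sum_congr rfl fun j _ => ?_
  simp [Fin.snocEquiv, Fin.prod_univ_castSucc, mul_assoc]

variable {E : Type*} [NormedAddCommGroup E] [InnerProductSpace ℝ E]
  {ι : Type*} [Fintype ι] {p : ι → ℝ}

/-- The variance is at most the second moment. -/
lemma sum_mul_norm_sub_mean_sq_le (hps : ∑ j, p j = 1) (Y : ι → E) :
    ∑ j, p j * ‖Y j - ∑ k, p k • Y k‖ ^ 2 ≤ ∑ j, p j * ‖Y j‖ ^ 2 := by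
  set m := ∑ k, p k • Y k with hm
  have h1 : ∑ j, p j * ‖Y j - m‖ ^ 2
      = ∑ j, p j * ‖Y j‖ ^ 2 - 2 * ∑ j, p j * ⟪Y j, m⟫_ℝ + (∑ j, p j) * ‖m‖ ^ 2 := by
    rw [Finset.mul_sum, Finset.sum_mul, ← Finset.sum_sub_distrib, ← Finset.sum_add_distrib]
    refine Finset.sum_congr rfl fun j _ => ?_
    rw [norm_sub_sq_real]
    ring
  have h2 : ∑ j, p j * ⟪Y j, m⟫_ℝ = ‖m‖ ^ 2 := by
    rw [← real_inner_self_eq_norm_sq]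
    conv_rhs => enter [2]; rw [hm]
    simp [sum_inner, real_inner_smul_left]
  rw [h1, h2, hps]
  nlinarith [sq_nonneg ‖m‖]

/-- Young's inequality for the squared norm of a difference. -/
lemma norm_sub_sq_le_young {β : ℝ} (hβ : 0 < β) (a b : E) :
    ‖a - b‖ ^ 2 ≤ (1 + β) * ‖a‖ ^ 2 + (1 + 1 / β) * ‖b‖ ^ 2 := by
  have h : 0 ≤ 1 / β * ‖β • a + b‖ ^ 2 := by positivity
  rw [norm_add_sq_real, norm_smul, real_inner_smul_left, Real.norm_of_nonneg hβ.le] at h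
  have h' : 1 / β * ((β * ‖a‖) ^ 2 + 2 * (β * ⟪a, b⟫_ℝ) + ‖b‖ ^ 2)
      = β * ‖a‖ ^ 2 + 2 * ⟪a, b⟫_ℝ + 1 / β * ‖b‖ ^ 2 := by
    field_simp
  rw [norm_sub_sq_real]
  linarith

/-- Expected squared distance after a step along an importance-weighted, variance-reduced
gradient estimate. -/
lemma sum_mul_norm_step_sq_le (hp : ∀ j, 0 < p j) (hps : ∑ j, p j = 1) {N : ℝ} (hN : N ≠ 0)
    {β : ℝ} (hβ : 0 < β) (α : ℝ) (d : E) (u v : ι → E) :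
    ∑ j, p j * ‖d - α • ((1 / (N * p j)) • (u j - v j) + (1 / N) • ∑ i, v i)‖ ^ 2
      ≤ ‖d‖ ^ 2 - 2 * α / N * ⟪d, ∑ i, u i⟫_ℝ
        + α ^ 2 / N ^ 2 * ((1 + β) * ∑ i, 1 / p i * ‖u i‖ ^ 2
          + (1 + 1 / β) * ∑ i, 1 / p i * ‖v i‖ ^ 2) := by
  set g : ι → E := fun j => (1 / (N * p j)) • (u j - v j) + (1 / N) • ∑ i, v i with hg
  set X : ι → E := fun j => (1 / (N * p j)) • u j with hX
  set Y : ι → E := fun j => (1 / (N * p j)) • v j with hY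
  have hscal : ∀ j, p j * (1 / (N * p j)) = 1 / N := fun j => by
    have := (hp j).ne'
    field_simp
  have hmeanY : ∑ k, p k • Y k = (1 / N) • ∑ i, v i := by
    simp only [hY, smul_smul, hscal, Finset.smul_sum]
  have hmeang : ∑ j, p j • g j = (1 / N) • ∑ i, u i := by
    simp only [hg, smul_add, smul_smul, hscal, smul_sub, Finset.sum_add_distrib,
      Finset.sum_sub_distrib, ← Finset.sum_smul, ← Finset.sum_mul, hps, one_mul,
      ← Finset.smul_sum]
    abel
  have hexpand : ∑ j, p j * ‖d - α • g j‖ ^ 2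
      = ‖d‖ ^ 2 - 2 * α / N * ⟪d, ∑ i, u i⟫_ℝ + α ^ 2 * ∑ j, p j * ‖g j‖ ^ 2 := by
    have h1 : ∑ j, p j * ‖d - α • g j‖ ^ 2 = (∑ j, p j) * ‖d‖ ^ 2
        - 2 * α * ∑ j, p j * ⟪d, g j⟫_ℝ + α ^ 2 * ∑ j, p j * ‖g j‖ ^ 2 := by
      rw [Finset.mul_sum, Finset.mul_sum, Finset.sum_mul, ← Finset.sum_sub_distrib,
        ← Finset.sum_add_distrib]
      refine Finset.sum_congr rfl fun j _ => ?_
      rw [norm_sub_sq_real, norm_smul, real_inner_smul_right, mul_pow, Real.norm_eq_abs, sq_abs]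
      ring
    have h2 : ∑ j, p j * ⟪d, g j⟫_ℝ = 1 / N * ⟪d, ∑ i, u i⟫_ℝ := by
      rw [← real_inner_smul_right, ← hmeang]
      simp [inner_sum, real_inner_smul_right]
    rw [h1, h2, hps]
    ring
  have hsq : ∀ (w : ι → E) (j : ι),
      p j * ‖(1 / (N * p j)) • w j‖ ^ 2 = 1 / N ^ 2 * (1 / p j * ‖w j‖ ^ 2) := by
    intro w j
    have := (hp j).ne'
    rw [norm_smul, mul_pow, Real.norm_eq_abs, sq_abs]
    field_simp
  have hsecond : ∑ j, p j * ‖g j‖ ^ 2 ≤ (1 + β) * ∑ j, p j * ‖X j‖ ^ 2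
      + (1 + 1 / β) * ∑ j, p j * ‖Y j‖ ^ 2 := by
    have h1 : ∑ j, p j * ‖g j‖ ^ 2 ≤ (1 + β) * ∑ j, p j * ‖X j‖ ^ 2
        + (1 + 1 / β) * ∑ j, p j * ‖Y j - ∑ k, p k • Y k‖ ^ 2 := by
      rw [Finset.mul_sum, Finset.mul_sum, ← Finset.sum_add_distrib]
      refine Finset.sum_le_sum fun j _ => ?_
      have hgj : g j = X j - (Y j - ∑ k, p k • Y k) := by
        rw [hmeanY]
        simp only [hg, hX, hY, smul_sub]
        abel
      have h := norm_sub_sq_le_young hβ (X j) (Y j - ∑ k, p k • Y k)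
      rw [← hgj] at h
      linarith [mul_le_mul_of_nonneg_left h (hp j).le]
    have h2 : 0 ≤ 1 + 1 / β := by positivity
    linarith [mul_le_mul_of_nonneg_left (sum_mul_norm_sub_mean_sq_le hps Y) h2]
  simp only [hX, hY, hsq, ← Finset.mul_sum] at hsecond
  rw [hexpand]
  have h3 := mul_le_mul_of_nonneg_left hsecond (sq_nonneg α)
  refine (add_le_add_right h3 _).trans_eq ?_
  ring

/-- Expected memory error after refreshing one randomly chosen entry. -/
lemma sum_mul_sum_update {E ι : Type*} [NormedAddCommGroup E] [Fintype ι] [DecidableEq ι]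
    {p : ι → ℝ} (hp : ∀ j, 0 < p j) (hps : ∑ j, p j = 1)
    (s h z : ι → E) :
    ∑ j, p j * ∑ i, 1 / p i * ‖Function.update s j (h j) i - z i‖ ^ 2
      = ∑ i, 1 / p i * ‖s i - z i‖ ^ 2 - ∑ i, ‖s i - z i‖ ^ 2 + ∑ i, ‖h i - z i‖ ^ 2 := by
  have hone : ∀ i, ∑ j, p j * ‖Function.update s j (h j) i - z i‖ ^ 2
      = ‖s i - z i‖ ^ 2 + p i * (‖h i - z i‖ ^ 2 - ‖s i - z i‖ ^ 2) := by
    intro i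
    have h1 : ∀ j, p j * ‖Function.update s j (h j) i - z i‖ ^ 2 = p j * ‖s i - z i‖ ^ 2
        + if i = j then p j * (‖h j - z j‖ ^ 2 - ‖s j - z j‖ ^ 2) else 0 := by
      intro j
      by_cases hij : i = j
      · subst hij
        simp
        ring
      · simp [hij]
    simp [h1, Finset.sum_add_distrib, ← Finset.sum_mul, hps]
  simp only [Finset.mul_sum]
  rw [Finset.sum_comm, ← Finset.sum_sub_distrib, ← Finset.sum_add_distrib]
  refine Finset.sum_congr rfl fun i _ => ?_
  have h2 : ∑ j, p j * (1 / p i * ‖Function.update s j (h j) i - z i‖ ^ 2)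
      = 1 / p i * ∑ j, p j * ‖Function.update s j (h j) i - z i‖ ^ 2 := by
    rw [Finset.mul_sum]
    exact Finset.sum_congr rfl fun j _ => by ring
  have := (hp i).ne'
  rw [h2, hone]
  field_simp
  ring

end Sampling

section LyapunovStep

/-- One-step recursion for the squared distance `a` and the scaled memory error `S`: the distance
and the combination `2 * (1 - θ) / (2 - θ) * a + S` satisfy a closed system of inequalities. -/
lemma lyapunov_step_of_scalar_bounds {θ q a S H J a' S' : ℝ} (hθ : 0 ≤ θ) (hθ1 : θ < 1)
    (hq : 0 ≤ q) (ha : 0 ≤ a) (hH : 0 ≤ H)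
    (hJ : 2 * θ * q * a ≤ J) (hJH : θ * q * a + 2 / (1 - θ) * H ≤ J)
    (ha' : a' ≤ a - J + (2 - θ) / (2 * (1 - θ)) * H + (1 - θ / 2) * q * S)
    (hS' : S' ≤ (1 - q) * S + H) :
    a' ≤ (1 - θ * q - (1 - θ / 2) * q) * a
        + (1 - θ / 2) * q * (2 * (1 - θ) / (2 - θ) * a + S) ∧
      2 * (1 - θ) / (2 - θ) * a' + S'
        ≤ (1 - θ * q) * (2 * (1 - θ) / (2 - θ) * a + S) := by
  have h1 : 0 < 1 - θ := by linarith
  have h2 : 0 < 2 - θ := by linarith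
  have hκ : (1 - θ / 2) * (2 * (1 - θ) / (2 - θ)) = 1 - θ := by field_simp
  constructor
  · have hmix := add_le_add (mul_le_mul_of_nonneg_left hJ (by linarith : 0 ≤ (2 + θ) / 4))
      (mul_le_mul_of_nonneg_left hJH (by linarith : 0 ≤ (2 - θ) / 4))
    have hH' : (2 - θ) / 4 * (2 / (1 - θ) * H) = (2 - θ) / (2 * (1 - θ)) * H := by
      field_simp; ring
    have hθa : 0 ≤ θ * q * a * θ := by positivity
    have hκa : (1 - θ / 2) * q * (2 * (1 - θ) / (2 - θ) * a) = (1 - θ) * q * a := by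
      linear_combination q * a * hκ
    rw [mul_add ((1 - θ / 2) * q), hκa]
    linarith
  · have hκ0 : 0 ≤ 2 * (1 - θ) / (2 - θ) := by positivity
    have hmul := mul_le_mul_of_nonneg_left (ha'.trans (by linarith :
      _ ≤ a - (θ * q * a + 2 / (1 - θ) * H) + (2 - θ) / (2 * (1 - θ)) * H
        + (1 - θ / 2) * q * S)) hκ0
    have hκH : 2 * (1 - θ) / (2 - θ) * (2 / (1 - θ) * H - (2 - θ) / (2 * (1 - θ)) * H)
        = (2 + θ) / (2 - θ) * H := by
      field_simp; ring
    have hH1 : H ≤ (2 + θ) / (2 - θ) * H :=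
      le_mul_of_one_le_left hH ((one_le_div h2).2 (by linarith))
    have hκS : 2 * (1 - θ) / (2 - θ) * ((1 - θ / 2) * q * S) = (1 - θ) * q * S := by
      linear_combination q * S * hκ
    linarith

variable {E : Type*} [NormedAddCommGroup E] [InnerProductSpace ℝ E]
  {ι : Type*} [Fintype ι] [DecidableEq ι] {p : ι → ℝ}

/-- One-step Lyapunov inequalities for SAGA with non-uniform sampling. Here `d` is the distance
to the minimizer, `h` the current gradients, `s` the stored ones and `z` those at the
minimizer. -/
lemma saga_lyapunov_step [Nonempty ι] (hp : ∀ j, 0 < p j) (hps : ∑ j, p j = 1) {q μ L N α θ C : ℝ}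
    (hq : 0 < q) (hqp : ∀ j, q ≤ p j) (hμ : 0 < μ) (hL : 0 < L) (hN : N = Fintype.card ι)
    (hα : α = N * q / (4 * L + N * μ)) (hθ : θ = N * μ / (4 * L + N * μ))
    (hC : C = 2 * q / (4 * L + N * μ) ^ 2) (d : E) (h s z : ι → E) (hz : ∑ i, z i = 0)
    (hmono : ∀ i, μ * ‖d‖ ^ 2 ≤ ⟪d, h i - z i⟫_ℝ)
    (hcoc : ∀ i, ‖h i - z i‖ ^ 2 ≤ L * ⟪d, h i - z i⟫_ℝ) :
    ∑ j, p j * ‖d - α • ((1 / (N * p j)) • (h j - s j) + (1 / N) • ∑ i, s i)‖ ^ 2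
        ≤ (1 - θ * q - (1 - θ / 2) * q) * ‖d‖ ^ 2 + (1 - θ / 2) * q *
          (2 * (1 - θ) / (2 - θ) * ‖d‖ ^ 2 + C * ∑ i, 1 / p i * ‖s i - z i‖ ^ 2) ∧
      ∑ j, p j * (2 * (1 - θ) / (2 - θ) *
          ‖d - α • ((1 / (N * p j)) • (h j - s j) + (1 / N) • ∑ i, s i)‖ ^ 2
          + C * ∑ i, 1 / p i * ‖Function.update s j (h j) i - z i‖ ^ 2)
        ≤ (1 - θ * q) *
          (2 * (1 - θ) / (2 - θ) * ‖d‖ ^ 2 + C * ∑ i, 1 / p i * ‖s i - z i‖ ^ 2) := by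
  have hN0 : 0 < N := by rw [hN]; exact_mod_cast Fintype.card_pos
  have hD : 0 < 4 * L + N * μ := by positivity
  have hα0 : 0 < α := by rw [hα]; positivity
  have hθ0 : 0 ≤ θ := by rw [hθ]; positivity
  have h1θ : 1 - θ = 4 * L / (4 * L + N * μ) := by rw [hθ]; field_simp; ring
  have h1θ0 : 0 < 1 - θ := by rw [h1θ]; positivity
  have hC0 : 0 < C := by rw [hC]; positivity
  have hsplit : ∑ j, p j * (2 * (1 - θ) / (2 - θ) *
          ‖d - α • ((1 / (N * p j)) • (h j - s j) + (1 / N) • ∑ i, s i)‖ ^ 2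
          + C * ∑ i, 1 / p i * ‖Function.update s j (h j) i - z i‖ ^ 2)
      = 2 * (1 - θ) / (2 - θ) *
          (∑ j, p j * ‖d - α • ((1 / (N * p j)) • (h j - s j) + (1 / N) • ∑ i, s i)‖ ^ 2)
        + C * ∑ j, p j * ∑ i, 1 / p i * ‖Function.update s j (h j) i - z i‖ ^ 2 := by
    rw [Finset.mul_sum, Finset.mul_sum, ← Finset.sum_add_distrib]
    exact Finset.sum_congr rfl fun j _ => by ring
  rw [hsplit, sum_mul_sum_update hp hps]
  have hstep := sum_mul_norm_step_sq_le hp hps hN0.ne' (β := 1 / (1 - θ)) (by positivity) α d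
    (fun i => h i - z i) (fun i => s i - z i)
  simp only [sub_sub_sub_cancel_right, Finset.sum_sub_distrib, hz, sub_zero] at hstep
  have hI1 : N * μ * ‖d‖ ^ 2 ≤ ⟪d, ∑ i, h i⟫_ℝ := by
    have := Finset.sum_le_sum fun i (_ : i ∈ Finset.univ) => hmono i
    rw [← inner_sum, Finset.sum_sub_distrib, hz, sub_zero, Finset.sum_const, nsmul_eq_mul,
      Finset.card_univ, ← hN] at this
    linarith
  have hI2 : ∑ i, ‖h i - z i‖ ^ 2 ≤ L * ⟪d, ∑ i, h i⟫_ℝ := by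
    have := Finset.sum_le_sum fun i (_ : i ∈ Finset.univ) => hcoc i
    rwa [← Finset.mul_sum, ← inner_sum, Finset.sum_sub_distrib, hz, sub_zero] at this
  have hHq : ∑ i, 1 / p i * ‖h i - z i‖ ^ 2 ≤ 1 / q * ∑ i, ‖h i - z i‖ ^ 2 := by
    rw [Finset.mul_sum]
    refine Finset.sum_le_sum fun i _ => ?_
    have := hqp i
    gcongr
  have hSq : q * ∑ i, 1 / p i * ‖s i - z i‖ ^ 2 ≤ ∑ i, ‖s i - z i‖ ^ 2 := by
    rw [Finset.mul_sum]
    refine Finset.sum_le_sum fun i _ => ?_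
    rw [← mul_assoc, mul_one_div]
    exact mul_le_of_le_one_left (sq_nonneg _) ((div_le_one (hp i)).2 (hqp i))
  have hH0 : 0 ≤ ∑ i, ‖h i - z i‖ ^ 2 := Finset.sum_nonneg fun i _ => sq_nonneg _
  set H := ∑ i, ‖h i - z i‖ ^ 2
  set S := ∑ i, 1 / p i * ‖s i - z i‖ ^ 2
  set I := ⟪d, ∑ i, h i⟫_ℝ
  have hαN : α ^ 2 / N ^ 2 = C * q / 2 := by rw [hα, hC]; field_simp
  have hcoefN : 2 * α / N * (N * μ) = 2 * θ * q := by rw [hα, hθ]; field_simp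
  have hcoefL : α / N / L = 2 / (1 - θ) * C := by rw [h1θ, hα, hC]; field_simp; ring
  have h2αN : 0 < 2 * α / N := by positivity
  refine lyapunov_step_of_scalar_bounds (H := C * H) (J := 2 * α / N * I) hθ0 (by linarith) hq.le
    (sq_nonneg _) (by positivity) ?_ ?_ ?_ ?_
  · rw [← hcoefN, mul_assoc]
    exact mul_le_mul_of_nonneg_left hI1 h2αN.le
  · have h1 := mul_le_mul_of_nonneg_left hI1 h2αN.le
    rw [← mul_assoc, hcoefN] at h1
    have h2 := mul_le_mul_of_nonneg_left hI2 (by positivity : 0 ≤ α / N / L)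
    have h3 : α / N / L * (L * I) = 2 * α / N * I / 2 := by field_simp
    rw [h3, hcoefL] at h2
    linarith
  · refine hstep.trans ?_
    have h1 : α ^ 2 / N ^ 2 * ((1 + 1 / (1 - θ)) * ∑ i, 1 / p i * ‖h i - z i‖ ^ 2)
        ≤ (2 - θ) / (2 * (1 - θ)) * (C * H) := by
      have h2 : (2 - θ) / (2 * (1 - θ)) * (C * H)
          = C * q / 2 * ((1 + 1 / (1 - θ)) * (1 / q * H)) := by
        field_simp; ring
      rw [hαN, h2]
      gcongr
    have h3 : α ^ 2 / N ^ 2 * ((1 + 1 / (1 / (1 - θ))) * S) = (1 - θ / 2) * q * (C * S) := by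
      rw [hαN, one_div_one_div]; ring
    rw [mul_add, h3]
    linarith
  · have := mul_le_mul_of_nonneg_left hSq hC0.le
    linarith

/-- A gradient step with a small step size contracts the distance to the minimizer. -/
lemma norm_gradient_step_sq_le {μ L α : ℝ} (hL : 0 < L) (hα : 0 ≤ α) (hαL : α * L ≤ 1)
    {d h : E} (hmono : μ * ‖d‖ ^ 2 ≤ ⟪d, h⟫_ℝ) (hcoc : ‖h‖ ^ 2 ≤ L * ⟪d, h⟫_ℝ) :
    ‖d - α • h‖ ^ 2 ≤ (1 - μ * α) * ‖d‖ ^ 2 := by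
  have h1 : α * ‖h‖ ^ 2 ≤ ⟪d, h⟫_ℝ := by
    have h0 : 0 ≤ L * ⟪d, h⟫_ℝ := (sq_nonneg _).trans hcoc
    have h0' : 0 ≤ ⟪d, h⟫_ℝ := (mul_nonneg_iff_of_pos_left hL).1 h0
    nlinarith [mul_le_mul_of_nonneg_left hcoc hα, mul_le_mul_of_nonneg_right hαL h0']
  rw [norm_sub_sq_real, norm_smul, real_inner_smul_right, mul_pow, Real.norm_eq_abs, sq_abs]
  nlinarith [mul_le_mul_of_nonneg_left h1 hα, mul_le_mul_of_nonneg_left hmono hα]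

end LyapunovStep

/-- Proposition 1(a): linear convergence of SAGA under any non-uniform
sampling scheme with positive probabilities. -/
theorem saga_nus_linear_convergence
    {E : Type*} [NormedAddCommGroup E] [InnerProductSpace ℝ E] [CompleteSpace E]
    {n : ℕ} (hn : 1 ≤ n)
    (f : Fin n → E → ℝ) (μ L : ℝ) (hμ : 0 < μ) (hμL : μ ≤ L)
    (hdiff : ∀ i, Differentiable ℝ (f i))
    (hsc : ∀ i, ConvexOn ℝ Set.univ (fun w => f i w - μ / 2 * ‖w‖ ^ 2))
    (hlip : ∀ i, ∀ w v : E, ‖gradient (f i) w - gradient (f i) v‖ ≤ L * ‖w - v‖)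
    (fbar : E → ℝ) (hfbar : fbar = fun w => (1 / n : ℝ) * ∑ i, f i w)
    (xstar : E) (hmin : ∀ w, fbar xstar ≤ fbar w)
    (p : Fin n → ℝ) (hp : ∀ j, 0 < p j) (hps : ∑ j, p j = 1)
    (pmin : ℝ) (hpmin_le : ∀ j, pmin ≤ p j) (hpmin_mem : ∃ j, p j = pmin)
    (α : ℝ) (hα : α = n * pmin / (4 * L + n * μ))
    (x0 : E)
    -- the trajectory along each path of sampled indices
    (x : (t : ℕ) → (Fin t → Fin n) → E)
    (s : (t : ℕ) → (Fin t → Fin n) → Fin n → E)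
    (hx0 : ∀ σ : Fin 0 → Fin n, x 0 σ = x0)
    (hs0 : ∀ (σ : Fin 0 → Fin n) (i : Fin n), s 0 σ i = gradient (f i) x0)
    (hxrec : ∀ (t : ℕ) (σ : Fin (t + 1) → Fin n),
      x (t + 1) σ = x t (σ ∘ Fin.castSucc) - α •
        ((1 / (n * p (σ (Fin.last t)))) •
            (gradient (f (σ (Fin.last t))) (x t (σ ∘ Fin.castSucc))
              - s t (σ ∘ Fin.castSucc) (σ (Fin.last t)))
          + (1 / n : ℝ) • ∑ i, s t (σ ∘ Fin.castSucc) i))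
    (hsrec : ∀ (t : ℕ) (σ : Fin (t + 1) → Fin n),
      s (t + 1) σ = Function.update (s t (σ ∘ Fin.castSucc)) (σ (Fin.last t))
        (gradient (f (σ (Fin.last t))) (x t (σ ∘ Fin.castSucc))))
    (Ca : ℝ)
    (hCa : Ca = (2 * pmin / (4 * L + n * μ) ^ 2) *
      ∑ i, (1 / p i) * ‖gradient (f i) x0 - gradient (f i) xstar‖ ^ 2) :
    ∀ t : ℕ, ∑ σ : Fin t → Fin n, (∏ k, p (σ k)) * ‖x t σ - xstar‖ ^ 2 ≤
      (1 - μ * α) ^ t * (‖x0 - xstar‖ ^ 2 + Ca) := by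
  subst hfbar
  have hn0 : (0 : ℝ) < n := by exact_mod_cast hn
  have hL : 0 < L := hμ.trans_le hμL
  have : Nonempty (Fin n) := ⟨⟨0, hn⟩⟩
  have hpmin : 0 < pmin := by
    obtain ⟨j, hj⟩ := hpmin_mem
    exact hj ▸ hp j
  have hD : 0 < 4 * L + n * μ := by positivity
  have hnpmin : n * pmin ≤ 1 := by
    have := Finset.sum_le_sum fun j (_ : j ∈ Finset.univ) => hpmin_le j
    simpa [hps] using this
  have hz : ∑ i, gradient (f i) xstar = 0 :=
    sum_gradient_eq_zero_of_forall_le (by positivity) hdiff hmin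
  have hmono : ∀ (w : E) (i : Fin n), μ * ‖w - xstar‖ ^ 2
      ≤ ⟪w - xstar, gradient (f i) w - gradient (f i) xstar⟫_ℝ :=
    fun w i => gradient_strongly_monotone (hdiff i) (hsc i) w xstar
  have hcoc : ∀ (w : E) (i : Fin n), ‖gradient (f i) w - gradient (f i) xstar‖ ^ 2
      ≤ L * ⟪w - xstar, gradient (f i) w - gradient (f i) xstar⟫_ℝ :=
    fun w i => gradient_cocoercive hμ.le hL (hdiff i) (hsc i) (hlip i) w xstar
  obtain ⟨θ, hθ⟩ : ∃ θ, θ = n * μ / (4 * L + n * μ) := ⟨_, rfl⟩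
  obtain ⟨C, hC⟩ : ∃ C, C = 2 * pmin / (4 * L + n * μ) ^ 2 := ⟨_, rfl⟩
  have hθ0 : 0 ≤ θ := by rw [hθ]; positivity
  have hθ1 : θ < 1 := by rw [hθ, div_lt_one hD]; linarith
  have hρ : 1 - μ * α = 1 - θ * pmin := by rw [hα, hθ]; ring
  have hpmin1 : pmin ≤ 1 := by
    have h1n : (1 : ℝ) ≤ n := by exact_mod_cast hn
    nlinarith
  have hρ0 : 0 ≤ 1 - θ * pmin := by nlinarith
  have hsnoc : ∀ (t : ℕ) (τ : Fin t → Fin n) (j : Fin n),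
      (Fin.snoc (α := fun _ => Fin n) τ j) ∘ Fin.castSucc = τ := by
    intro t τ j
    ext k
    simp
  have hxsnoc : ∀ (t : ℕ) (τ : Fin t → Fin n) (j : Fin n),
      x (t + 1) (Fin.snoc (α := fun _ => Fin n) τ j) - xstar = (x t τ - xstar) -
        α • ((1 / (n * p j)) • (gradient (f j) (x t τ) - s t τ j)
          + (1 / n : ℝ) • ∑ i, s t τ i) := by
    intro t τ j
    rw [hxrec, hsnoc, Fin.snoc_last]
    abel
  have hssnoc : ∀ (t : ℕ) (τ : Fin t → Fin n) (j : Fin n),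
      s (t + 1) (Fin.snoc (α := fun _ => Fin n) τ j)
        = Function.update (s t τ) j (gradient (f j) (x t τ)) := by
    intro t τ j
    rw [hsrec, hsnoc, Fin.snoc_last]
  have hstep := fun (t : ℕ) (τ : Fin t → Fin n) =>
    saga_lyapunov_step hp hps hpmin hpmin_le hμ hL (N := n) (by simp) hα hθ hC
      (x t τ - xstar) (fun i => gradient (f i) (x t τ)) (s t τ)
      (fun i => gradient (f i) xstar) hz (hmono _) (hcoc _)
  simp only [← hxsnoc, ← hssnoc] at hstep
  set B : (t : ℕ) → (Fin t → Fin n) → ℝ := fun t σ =>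
    2 * (1 - θ) / (2 - θ) * ‖x t σ - xstar‖ ^ 2
      + C * ∑ i, 1 / p i * ‖s t σ i - gradient (f i) xstar‖ ^ 2 with hB
  obtain ⟨c₀, c₁, hc₀, hc₁, hcρ, hA⟩ : ∃ c₀ c₁ : ℝ, 0 ≤ c₀ ∧ 0 ≤ c₁ ∧ c₀ + c₁ = 1 - θ * pmin ∧
      ∀ (t : ℕ) (τ : Fin t → Fin n),
        ∑ j, p j * ‖x (t + 1) (Fin.snoc (α := fun _ => Fin n) τ j) - xstar‖ ^ 2
          ≤ c₀ * ‖x t τ - xstar‖ ^ 2 + c₁ * B t τ := by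
    rcases hn.eq_or_lt with rfl | hn2
    · refine ⟨1 - θ * pmin, 0, hρ0, le_rfl, add_zero _, fun t τ => ?_⟩
      rw [Fin.sum_univ_one] at hps hz
      have h1 := hmono (x t τ) 0
      have h2 := hcoc (x t τ) 0
      rw [hz, sub_zero] at h1 h2
      have hαL : α * L ≤ 1 := by
        rw [hα, div_mul_eq_mul_div, div_le_one hD]
        nlinarith
      have h3 := norm_gradient_step_sq_le hL (by rw [hα]; positivity) hαL h1 h2
      rw [hρ] at h3
      simpa [hxsnoc, hps, ← smul_add] using h3
    · have hn2' : (2 : ℝ) ≤ n := by exact_mod_cast hn2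
      have hpmin2 : pmin ≤ 1 / 2 := by nlinarith
      refine ⟨1 - θ * pmin - (1 - θ / 2) * pmin, (1 - θ / 2) * pmin, by nlinarith, ?_, by ring,
        fun t τ => (hstep t τ).1⟩
      exact mul_nonneg (by linarith) hpmin.le
  have hw : ∀ (t : ℕ) (τ : Fin t → Fin n), 0 ≤ ∏ k, p (τ k) :=
    fun t τ => Finset.prod_nonneg fun k _ => (hp _).le
  have hCa0 : 0 ≤ Ca := by
    rw [hCa]
    exact mul_nonneg (by positivity) (Finset.sum_nonneg fun i _ =>
      mul_nonneg (one_div_nonneg.2 (hp i).le) (sq_nonneg _))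
  have hκ1 : 2 * (1 - θ) / (2 - θ) ≤ 1 := by
    rw [div_le_one (by linarith)]
    linarith
  rw [hρ]
  have key : ∀ t : ℕ,
      ∑ σ : Fin t → Fin n, (∏ k, p (σ k)) * ‖x t σ - xstar‖ ^ 2
          ≤ (1 - θ * pmin) ^ t * (‖x0 - xstar‖ ^ 2 + Ca) ∧
        ∑ σ : Fin t → Fin n, (∏ k, p (σ k)) * B t σ
          ≤ (1 - θ * pmin) ^ t * (‖x0 - xstar‖ ^ 2 + Ca) := by
    intro t
    induction t with
    | zero =>
      have hB0 : ∀ σ, B 0 σ = 2 * (1 - θ) / (2 - θ) * ‖x0 - xstar‖ ^ 2 + Ca := by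
        intro σ
        simp only [hB, hx0, hs0, hCa, hC]
      constructor
      · simp [hx0, hCa0]
      · simpa [hB0] using mul_le_of_le_one_left (sq_nonneg ‖x0 - xstar‖) hκ1
    | succ t ih =>
      constructor
      · rw [sum_path_succ p (fun σ => ‖x (t + 1) σ - xstar‖ ^ 2)]
        calc _ ≤ ∑ τ : Fin t → Fin n, (∏ k, p (τ k)) *
              (c₀ * ‖x t τ - xstar‖ ^ 2 + c₁ * B t τ) :=
              Finset.sum_le_sum fun τ _ => mul_le_mul_of_nonneg_left (hA t τ) (hw t τ)
          _ = c₀ * ∑ τ : Fin t → Fin n, (∏ k, p (τ k)) * ‖x t τ - xstar‖ ^ 2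
              + c₁ * ∑ τ : Fin t → Fin n, (∏ k, p (τ k)) * B t τ := by
              rw [Finset.mul_sum, Finset.mul_sum, ← Finset.sum_add_distrib]
              exact Finset.sum_congr rfl fun τ _ => by ring
          _ ≤ c₀ * ((1 - θ * pmin) ^ t * (‖x0 - xstar‖ ^ 2 + Ca))
              + c₁ * ((1 - θ * pmin) ^ t * (‖x0 - xstar‖ ^ 2 + Ca)) :=
              add_le_add (mul_le_mul_of_nonneg_left ih.1 hc₀)
                (mul_le_mul_of_nonneg_left ih.2 hc₁)
          _ = _ := by rw [← add_mul, hcρ, pow_succ]; ring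
      · rw [sum_path_succ p (B (t + 1))]
        calc _ ≤ ∑ τ : Fin t → Fin n, (∏ k, p (τ k)) * ((1 - θ * pmin) * B t τ) :=
              Finset.sum_le_sum fun τ _ => mul_le_mul_of_nonneg_left (hstep t τ).2 (hw t τ)
          _ = (1 - θ * pmin) * ∑ τ : Fin t → Fin n, (∏ k, p (τ k)) * B t τ := by
              rw [Finset.mul_sum]
              exact Finset.sum_congr rfl fun τ _ => by ring
          _ ≤ (1 - θ * pmin) * ((1 - θ * pmin) ^ t * (‖x0 - xstar‖ ^ 2 + Ca)) :=
              mul_le_mul_of_nonneg_left ih.2 hρ0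
          _ = _ := by rw [pow_succ]; ring
  exact fun t => (key t).1
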